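/- Let f : X → B be a submetry between metric spaces. If X is a complete metric space, then B is complete. -/

import Mathlib

/-- A map between pseudometric spaces is a submetry (the paper's H-fibration) if it is
1-Lipschitz, surjective, and the Hausdorff extended distance between any two fibers is
bounded by the distance between the base points. -/
def IsSubmetry {X B : Type*} [PseudoMetricSpace X] [PseudoMetricSpace B] (f : X → B) : Prop :=
  (∀ x x', dist (f x) (f x') ≤ dist x x') ∧ Function.Surjective f ∧
    ∀ b₀ b₁ : B, EMetric.hausdorffEdist (f ⁻¹' {b₀}) (f ⁻¹' {b₁}) ≤ ENNReal.ofReal (dist b₀ b₁)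

/-- A submetry lifts a point `b` close to `f x` to a point close to `x`. -/
theorem IsSubmetry.exists_lift_dist_lt {X B : Type*} [PseudoMetricSpace X] [PseudoMetricSpace B]
    {f : X → B} (hf : IsSubmetry f) {x : X} {b : B} {r : ℝ} (h : dist (f x) b < r) :
    ∃ y, f y = b ∧ dist x y < r := by
  have hr : 0 < r := dist_nonneg.trans_lt h
  obtain ⟨y, hy, hxy⟩ := Metric.exists_edist_lt_of_hausdorffEDist_lt
    (s := f ⁻¹' {f x}) (t := f ⁻¹' {b}) (x := x) rfl
    ((hf.2.2 (f x) b).trans_lt ((ENNReal.ofReal_lt_ofReal_iff hr).2 h))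
  rw [edist_dist, ENNReal.ofReal_lt_ofReal_iff hr] at hxy
  exact ⟨y, hy, hxy⟩

/-- If the source of a submetry between metric spaces is complete, so is the target. -/
theorem IsSubmetry.completeSpace {X B : Type*} [MetricSpace X] [MetricSpace B]
    (f : X → B) (hf : IsSubmetry f) [CompleteSpace X] : CompleteSpace B := by
  refine Metric.complete_of_convergent_controlled_sequences (fun n ↦ 1 / 2 / 2 ^ n)
    (fun n ↦ by positivity) fun u hu ↦ ?_
  obtain ⟨x₀, hx₀⟩ := hf.2.1 (u 0)
  have step (n : ℕ) (x : {x // f x = u n}) :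
      ∃ y : {y // f y = u (n + 1)}, dist x.1 y.1 < 1 / 2 / 2 ^ n := by
    obtain ⟨y, hy, hxy⟩ := hf.exists_lift_dist_lt (x := x.1) (b := u (n + 1))
      (by rw [x.2]; exact hu n n (n + 1) le_rfl n.le_succ)
    exact ⟨⟨y, hy⟩, hxy⟩
  choose next hnext using step
  let v (n : ℕ) : {x // f x = u n} :=
    Nat.rec (motive := fun n ↦ {x // f x = u n}) ⟨x₀, hx₀⟩ next n
  have hv : CauchySeq fun n ↦ (v n).1 :=
    cauchySeq_of_le_geometric_two (C := 1) fun n ↦ (hnext n (v n)).le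
  obtain ⟨x, hx⟩ := cauchySeq_tendsto_of_complete hv
  have hcont : Continuous f :=
    (LipschitzWith.of_dist_le_mul (K := 1) fun a b ↦ by simpa using hf.1 a b).continuous
  exact ⟨f x, ((hcont.tendsto x).comp hx).congr fun n ↦ (v n).2⟩
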